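/- Let Ω̄ be a d×d correlation matrix (symmetric positive definite with unit diagonal), α ∈ ℝ^d and τ ∈ ℝ. Let X be a random vector with density φ_d(·; Ω̄) and let X′ be a standard normal random variable independent of X. Then P(αᵀX + τ > X′) = Φ( τ / √(1 + αᵀΩ̄α) ), and for every Borel set B ⊆ ℝ^d, P( X ∈ B | αᵀX + τ > X′ ) = ∫_B φ_d(y; Ω̄) Φ(αᵀy + τ) / Φ( τ / √(1 + αᵀΩ̄α) ) dy; that is, the conditional law of X given αᵀX + τ > X′ is the extended skew-normal distribution with correlation matrix Ω̄, slant α and extension τ. -/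

import Mathlib

open MeasureTheory Real Filter Matrix Set Topology Asymptotics

noncomputable section

/-- Standard normal density. -/
def nPdf (x : ℝ) : ℝ := (Real.sqrt (2 * π))⁻¹ * Real.exp (-(x ^ 2) / 2)

/-- Standard normal distribution function. -/
def nCdf (x : ℝ) : ℝ := ∫ u in Set.Iio x, nPdf u

/-- Centred multivariate normal density with covariance matrix `S`. -/
def mvnPdf {ι : Type*} [Fintype ι] [DecidableEq ι] (S : Matrix ι ι ℝ) (y : ι → ℝ) : ℝ :=
  (2 * π) ^ (-(Fintype.card ι : ℝ) / 2) * S.det ^ (-(1 : ℝ) / 2) *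
    Real.exp (-(y ⬝ᵥ S⁻¹.mulVec y) / 2)

/-- Centred multivariate normal distribution function. -/
def mvnCdf {ι : Type*} [Fintype ι] [DecidableEq ι] (S : Matrix ι ι ℝ) (w : ι → ℝ) : ℝ :=
  ∫ u in Set.univ.pi fun i => Set.Iic (w i), mvnPdf S u

/-- Multivariate central Student-t density with scale matrix `S` and `ν` degrees of freedom. -/
def tPdf {ι : Type*} [Fintype ι] [DecidableEq ι] (S : Matrix ι ι ℝ) (ν : ℝ) (y : ι → ℝ) : ℝ :=
  Real.Gamma ((ν + Fintype.card ι) / 2) *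
      (1 + y ⬝ᵥ S⁻¹.mulVec y / ν) ^ (-(ν + Fintype.card ι) / 2) /
    (Real.Gamma (ν / 2) * (ν * π) ^ ((Fintype.card ι : ℝ) / 2) * Real.sqrt S.det)

/-- Univariate non-central t distribution function with non-centrality `a`. -/
def nctCdf (x a ν : ℝ) : ℝ :=
  ∫ v in Set.Ioi (0 : ℝ),
    v ^ (ν / 2 - 1) * Real.exp (-v) / Real.Gamma (ν / 2) *
      nCdf (x * Real.sqrt (2 * v / ν) - a)

/-- Multivariate non-central t distribution function. -/
def mvnctCdf {ι : Type*} [Fintype ι] [DecidableEq ι]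
    (y : ι → ℝ) (S : Matrix ι ι ℝ) (κ : ι → ℝ) (ν : ℝ) : ℝ :=
  ∫ v in Set.Ioi (0 : ℝ),
    v ^ (ν / 2 - 1) * Real.exp (-v) / Real.Gamma (ν / 2) *
      mvnCdf S fun i => y i * Real.sqrt (2 * v / ν) - κ i

/-- Multivariate non-central t density (scale-mixture form). -/
def mvnctPdf {ι : Type*} [Fintype ι] [DecidableEq ι]
    (μ : ι → ℝ) (S : Matrix ι ι ℝ) (κ : ι → ℝ) (ν : ℝ) (y : ι → ℝ) : ℝ :=
  ∫ v in Set.Ioi (0 : ℝ),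
    v ^ (ν / 2 - 1) * Real.exp (-v) / Real.Gamma (ν / 2) *
      ((2 * v / ν) ^ ((Fintype.card ι : ℝ) / 2) *
        mvnPdf S fun i => Real.sqrt (2 * v / ν) * (y i - μ i) - κ i)

/-- Univariate non-central t density with location `μ`, scale (standard deviation) `s`,
non-centrality `κ` and `ν` degrees of freedom. -/
def nctPdf1 (μ s κ ν x : ℝ) : ℝ :=
  ∫ v in Set.Ioi (0 : ℝ),
    v ^ (ν / 2 - 1) * Real.exp (-v) / Real.Gamma (ν / 2) *
      (Real.sqrt (2 * v / ν) * s⁻¹ * nPdf (Real.sqrt (2 * v / ν) * (x - μ) / s - κ))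

/-- Non-central extended skew-t density. -/
def skewTPdf {ι : Type*} [Fintype ι] [DecidableEq ι]
    (μ : ι → ℝ) (Ω : Matrix ι ι ℝ) (α : ι → ℝ) (τ κ ν : ℝ) (y : ι → ℝ) : ℝ :=
  let d : ℝ := Fintype.card ι
  let ω : Matrix ι ι ℝ := Matrix.diagonal fun i => Real.sqrt (Ω i i)
  let Ωb : Matrix ι ι ℝ := ω⁻¹ * Ω * ω⁻¹
  let z : ι → ℝ := ω⁻¹.mulVec fun i => y i - μ i
  let Q : ℝ := α ⬝ᵥ Ωb.mulVec α
  tPdf Ω ν (fun i => y i - μ i) *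
      nctCdf ((α ⬝ᵥ z + τ) * Real.sqrt ((ν + d) / (ν + z ⬝ᵥ Ωb⁻¹.mulVec z))) κ (ν + d) /
    nctCdf (τ / Real.sqrt (1 + Q)) (κ / Real.sqrt (1 + Q)) ν

/-- Non-central extended skew-t distribution function. -/
def skewTCdf {ι : Type*} [Fintype ι] [DecidableEq ι]
    (μ : ι → ℝ) (Ω : Matrix ι ι ℝ) (α : ι → ℝ) (τ κ ν : ℝ) (y : ι → ℝ) : ℝ :=
  ∫ u in Set.univ.pi fun i => Set.Iic (y i), skewTPdf μ Ω α τ κ ν u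



open scoped MatrixOrder Matrix.Norms.L2Operator in
lemma aux_factor {d : ℕ} {S : Matrix (Fin d) (Fin d) ℝ} (hS : S.PosDef) :
    ∃ A : Matrix (Fin d) (Fin d) ℝ, S = A * Aᵀ := by
  obtain ⟨B, hB⟩ := CStarAlgebra.nonneg_iff_eq_star_mul_self.mp hS.posSemidef.nonneg
  refine ⟨Bᵀ, ?_⟩
  rw [hB, star_eq_conjTranspose, conjTranspose_eq_transpose_of_trivial, transpose_transpose]

open ProbabilityTheory in
lemma aux_nPdf_eq : nPdf = gaussianPDFReal 0 1 := by
  ext x; simp [nPdf, gaussianPDFReal]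

lemma aux_nPdf_nonneg (x : ℝ) : 0 ≤ nPdf x := by unfold nPdf; positivity

lemma aux_nPdf_meas : Measurable nPdf := by unfold nPdf; fun_prop

open ProbabilityTheory in
lemma aux_nPdf_int : Integrable nPdf := by
  rw [aux_nPdf_eq]; exact integrable_gaussianPDFReal _ _

open ProbabilityTheory in
lemma aux_gauss : gaussianReal 0 1 = volume.withDensity fun x => ENNReal.ofReal (nPdf x) := by
  rw [gaussianReal_of_var_ne_zero _ one_ne_zero, aux_nPdf_eq]; rfl

open ProbabilityTheory in
lemma aux_gauss_Iio (x : ℝ) : gaussianReal 0 1 (Iio x) = ENNReal.ofReal (nCdf x) := by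
  rw [gaussianReal_apply_eq_integral _ one_ne_zero, nCdf, aux_nPdf_eq]

lemma aux_nCdf_nonneg (x : ℝ) : 0 ≤ nCdf x :=
  integral_nonneg fun _ => aux_nPdf_nonneg _

lemma aux_nCdf_meas : Measurable nCdf := by
  refine Monotone.measurable fun a b hab => ?_
  exact setIntegral_mono_set aux_nPdf_int.integrableOn (ae_of_all _ aux_nPdf_nonneg)
    (Iio_subset_Iio hab).eventuallyLE

open ProbabilityTheory in
lemma aux_pi (d : ℕ) : Measure.pi (fun _ : Fin d => gaussianReal 0 1) =
    volume.withDensity fun z : Fin d → ℝ => ENNReal.ofReal (∏ i, nPdf (z i)) := by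
  refine Measure.pi_eq fun s hs => ?_
  rw [withDensity_apply _ (MeasurableSet.univ_pi hs), volume_pi, Measure.restrict_pi_pi,
    ← ofReal_integral_eq_lintegral_ofReal, integral_fintype_prod_eq_prod (f := fun _ x => nPdf x),
    ENNReal.ofReal_prod_of_nonneg]
  · refine Finset.prod_congr rfl fun i _ => ?_
    rw [gaussianReal_apply_eq_integral _ one_ne_zero, aux_nPdf_eq]
  · exact fun i _ => integral_nonneg fun _ => aux_nPdf_nonneg _
  · exact Integrable.fintype_prod fun i => aux_nPdf_int.restrict
  · exact ae_of_all _ fun z => Finset.prod_nonneg fun i _ => aux_nPdf_nonneg _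

lemma aux_mvn_nonneg {d : ℕ} {S : Matrix (Fin d) (Fin d) ℝ} (hS : S.PosDef) (y : Fin d → ℝ) :
    0 ≤ mvnPdf S y := by
  have := hS.det_pos
  unfold mvnPdf; positivity

lemma aux_mvn_meas {d : ℕ} (S : Matrix (Fin d) (Fin d) ℝ) : Measurable (mvnPdf S) := by
  unfold mvnPdf
  have : Continuous fun y : Fin d → ℝ => y ⬝ᵥ S⁻¹.mulVec y := by fun_prop
  fun_prop

lemma aux_key {d : ℕ} {S A : Matrix (Fin d) (Fin d) ℝ} (hS : S.PosDef) (hA : S = A * Aᵀ)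
    (z : Fin d → ℝ) : |A.det| * mvnPdf S (A *ᵥ z) = ∏ i, nPdf (z i) := by
  have hdet : S.det = A.det ^ 2 := by rw [hA, det_mul, det_transpose, sq]
  have hp := hS.det_pos
  have hne : A.det ≠ 0 := by
    intro h; rw [hdet, h] at hp; simp at hp
  have hu : IsUnit A.det := hne.isUnit
  have hut : IsUnit Aᵀ.det := by rwa [det_transpose]
  have hq : (A *ᵥ z) ⬝ᵥ S⁻¹ *ᵥ (A *ᵥ z) = ∑ i, z i ^ 2 := by
    rw [hA, Matrix.mul_inv_rev, ← mulVec_mulVec, mulVec_mulVec z, nonsing_inv_mul _ hu, one_mulVec,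
      dotProduct_comm, dotProduct_mulVec, ← mulVec_transpose, mulVec_mulVec,
      mul_nonsing_inv _ hut, one_mulVec]
    simp [dotProduct, sq]
  have h1 : S.det ^ (-(1:ℝ) / 2) = |A.det|⁻¹ := by
    rw [hdet, neg_div, Real.rpow_neg (sq_nonneg _), ← Real.sqrt_eq_rpow, Real.sqrt_sq_eq_abs]
  have h2 : (2 * π) ^ (-(Fintype.card (Fin d) : ℝ) / 2) = ((Real.sqrt (2 * π))⁻¹) ^ d := by
    rw [neg_div, Real.rpow_neg (by positivity), Real.sqrt_eq_rpow, inv_pow, ← Real.rpow_natCast,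
      ← Real.rpow_mul (by positivity), Fintype.card_fin]
    congr 2; ring
  have habs : |A.det| ≠ 0 := abs_ne_zero.2 hne
  unfold mvnPdf nPdf
  rw [hq, h1, h2, Finset.prod_mul_distrib, ← Real.exp_sum, Finset.prod_const, Finset.card_univ,
    Fintype.card_fin, ← Finset.sum_div, Finset.sum_neg_distrib]
  field_simp

open ProbabilityTheory in
lemma aux_map {d : ℕ} {S A : Matrix (Fin d) (Fin d) ℝ} (hS : S.PosDef) (hA : S = A * Aᵀ) :
    (volume.withDensity fun y => ENNReal.ofReal (mvnPdf S y)) =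
      (Measure.pi (fun _ : Fin d => gaussianReal 0 1)).map (fun z => A *ᵥ z) := by
  have hdet : S.det = A.det ^ 2 := by rw [hA, det_mul, det_transpose, sq]
  have hp := hS.det_pos
  have hne : A.det ≠ 0 := by
    intro h; rw [hdet, h] at hp; simp at hp
  have hm : Measurable (fun z : Fin d → ℝ => A *ᵥ z) := by
    have : Continuous (fun z : Fin d → ℝ => A *ᵥ z) := by fun_prop
    exact this.measurable
  have hmap := Real.map_matrix_volume_pi_eq_smul_volume_pi hne
  have hc : (⇑(toLin' A) : (Fin d → ℝ) → (Fin d → ℝ)) = fun z => A *ᵥ z := by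
    ext z; simp
  rw [hc] at hmap
  have hmm := (aux_mvn_meas S).ennreal_ofReal
  ext s hs
  rw [Measure.map_apply hm hs, aux_pi, withDensity_apply _ hs, withDensity_apply _ (hm hs)]
  simp_rw [← aux_key hS hA, ENNReal.ofReal_mul (abs_nonneg _)]
  rw [lintegral_const_mul _ (f := fun z => ENNReal.ofReal (mvnPdf S (A *ᵥ z))) (hmm.comp hm),
    ← setLIntegral_map hs hmm hm, hmap, Measure.restrict_smul, lintegral_smul_measure,
    smul_eq_mul, ← mul_assoc, ← ENNReal.ofReal_mul (abs_nonneg _), ← abs_mul, mul_inv_cancel₀ hne]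
  simp

open ProbabilityTheory in
lemma aux_lin {d : ℕ} (c : Fin d → ℝ) :
    (Measure.pi (fun _ : Fin d => gaussianReal 0 1)).map (fun z => c ⬝ᵥ z) =
      gaussianReal 0 (c ⬝ᵥ c).toNNReal := by
  have hm : Measurable (fun z : Fin d → ℝ => c ⬝ᵥ z) := by
    have : Continuous (fun z : Fin d → ℝ => c ⬝ᵥ z) := by fun_prop
    exact this.measurable
  have : IsProbabilityMeasure ((Measure.pi (fun _ : Fin d => gaussianReal 0 1)).map
      (fun z => c ⬝ᵥ z)) := Measure.isProbabilityMeasure_map hm.aemeasurable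
  have hcc : 0 ≤ c ⬝ᵥ c := by
    unfold dotProduct; exact Finset.sum_nonneg fun i _ => mul_self_nonneg _
  apply Measure.ext_of_charFun
  ext t
  rw [charFun_gaussianReal, charFun_apply_real, integral_map hm.aemeasurable
    (Measurable.aestronglyMeasurable (by fun_prop))]
  have h1 : ∀ z : Fin d → ℝ, Complex.exp (t * (c ⬝ᵥ z : ℝ) * Complex.I) =
      ∏ i, Complex.exp (((t * c i : ℝ) : ℂ) * (z i : ℝ) * Complex.I) := by
    intro z
    rw [← Complex.exp_sum, dotProduct]
    push_cast
    rw [Finset.mul_sum, Finset.sum_mul]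
    congr 1
    refine Finset.sum_congr rfl fun i _ => ?_
    ring
  simp_rw [h1]
  rw [integral_fintype_prod_eq_prod
    (f := fun i x => Complex.exp (((t * c i : ℝ) : ℂ) * (x : ℝ) * Complex.I))]
  simp_rw [← charFun_apply_real, charFun_gaussianReal]
  rw [← Complex.exp_sum, Real.coe_toNNReal _ hcc, dotProduct]
  congr 1
  push_cast
  simp only [mul_zero, zero_mul, zero_sub, one_mul, Finset.sum_neg_distrib]
  rw [Finset.sum_mul, Finset.sum_div]
  congr 1
  refine Finset.sum_congr rfl fun i _ => ?_
  ring

open ProbabilityTheory in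
lemma aux_gauss_var (v : NNReal) (τ : ℝ) :
    gaussianReal 0 (v + 1) (Iio τ) = gaussianReal 0 1 (Iio (τ / Real.sqrt (1 + v))) := by
  have hpos : 0 < Real.sqrt (1 + v) := Real.sqrt_pos.2 (by positivity)
  have h := gaussianReal_map_const_mul (μ := 0) (v := 1) (Real.sqrt (1 + v))
  have h2 : (NNReal.mk (Real.sqrt (1 + v) ^ 2) (sq_nonneg _) * 1 : NNReal) = v + 1 := by
    ext
    rw [mul_one]
    change Real.sqrt (1 + v) ^ 2 = _
    rw [Real.sq_sqrt (by positivity)]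
    push_cast; ring
  rw [h2, mul_zero] at h
  rw [← h, Measure.map_apply (by fun_prop) measurableSet_Iio]
  congr 1
  ext x
  simp [lt_div_iff₀ hpos, mul_comm]

/-- conditioning-type stochastic representation of the extended skew-normal
distribution. -/
theorem extendedSkewNormal_conditioning_representation
    (d : ℕ) (Ωb : Matrix (Fin d) (Fin d) ℝ) (hpd : Ωb.PosDef)
    (hdiag : ∀ i, Ωb i i = 1) (α : Fin d → ℝ) (τ : ℝ)
    (μ : Measure ((Fin d → ℝ) × ℝ))
    (hμ : μ = volume.withDensity fun p =>
      ENNReal.ofReal (mvnPdf Ωb p.1 * nPdf p.2)) :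
    (μ {p : (Fin d → ℝ) × ℝ | p.2 < α ⬝ᵥ p.1 + τ}).toReal =
      nCdf (τ / Real.sqrt (1 + α ⬝ᵥ Ωb.mulVec α)) ∧
    ∀ B : Set (Fin d → ℝ), MeasurableSet B →
      (μ {p : (Fin d → ℝ) × ℝ | p.1 ∈ B ∧ p.2 < α ⬝ᵥ p.1 + τ}).toReal /
          (μ {p : (Fin d → ℝ) × ℝ | p.2 < α ⬝ᵥ p.1 + τ}).toReal =
        ∫ y in B,
          mvnPdf Ωb y * nCdf (α ⬝ᵥ y + τ) /
            nCdf (τ / Real.sqrt (1 + α ⬝ᵥ Ωb.mulVec α)) := by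
  have hnn := aux_mvn_nonneg hpd
  have hmm := aux_mvn_meas Ωb
  have hαm : Measurable (fun y : Fin d → ℝ => α ⬝ᵥ y) := by
    have : Continuous (fun z : Fin d → ℝ => α ⬝ᵥ z) := by fun_prop
    exact this.measurable
  have hμ' : μ = (volume.withDensity fun y => ENNReal.ofReal (mvnPdf Ωb y)).prod
      (ProbabilityTheory.gaussianReal 0 1) := by
    rw [hμ, aux_gauss, prod_withDensity hmm.ennreal_ofReal aux_nPdf_meas.ennreal_ofReal]
    simp_rw [ENNReal.ofReal_mul (hnn _)]
    rfl
  have hset : MeasurableSet {p : (Fin d → ℝ) × ℝ | p.2 < α ⬝ᵥ p.1 + τ} :=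
    measurableSet_lt measurable_snd ((hαm.comp measurable_fst).add_const _)
  have hfirst : (μ {p : (Fin d → ℝ) × ℝ | p.2 < α ⬝ᵥ p.1 + τ}).toReal =
      nCdf (τ / Real.sqrt (1 + α ⬝ᵥ Ωb.mulVec α)) := by
    obtain ⟨A, hA⟩ : ∃ A : Matrix (Fin d) (Fin d) ℝ, Ωb = A * Aᵀ :=
      aux_factor hpd
    have hAm : Measurable (fun z : Fin d → ℝ => A *ᵥ z) := by
      have : Continuous (fun z : Fin d → ℝ => A *ᵥ z) := by fun_prop
      exact this.measurable
    set k : Fin d → ℝ := -(Aᵀ *ᵥ α) with hk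
    have hkm : Measurable (fun y : Fin d → ℝ => k ⬝ᵥ y) := by
      have : Continuous (fun z : Fin d → ℝ => k ⬝ᵥ z) := by fun_prop
      exact this.measurable
    have hkk : k ⬝ᵥ k = α ⬝ᵥ Ωb *ᵥ α := by
      rw [hk, neg_dotProduct_neg, hA, ← mulVec_mulVec, dotProduct_mulVec α, ← mulVec_transpose]
    have hkk0 : 0 ≤ k ⬝ᵥ k := by
      unfold dotProduct; exact Finset.sum_nonneg fun i _ => mul_self_nonneg _
    have hconv := ProbabilityTheory.gaussianReal_conv_gaussianReal
      (m₁ := 0) (m₂ := 0) (v₁ := (k ⬝ᵥ k).toNNReal) (v₂ := 1)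
    have e : μ {p : (Fin d → ℝ) × ℝ | p.2 < α ⬝ᵥ p.1 + τ} =
        ProbabilityTheory.gaussianReal 0 ((k ⬝ᵥ k).toNNReal + 1) (Iio τ) := by
      rw [add_zero] at hconv
      rw [← hconv, Measure.conv, ← aux_lin, hμ', aux_map hpd hA]
      have e1 := Measure.map_prod_map (Measure.pi fun _ : Fin d => ProbabilityTheory.gaussianReal 0 1)
        (ProbabilityTheory.gaussianReal 0 1) hAm measurable_id
      have e2 := Measure.map_prod_map (Measure.pi fun _ : Fin d => ProbabilityTheory.gaussianReal 0 1)
        (ProbabilityTheory.gaussianReal 0 1) hkm measurable_id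
      rw [Measure.map_id] at e1 e2
      rw [e1, e2,
        Measure.map_apply (by fun_prop) hset, Measure.map_apply (by fun_prop) measurableSet_Iio,
        Measure.map_apply (by fun_prop) (measurableSet_Iio.preimage (by fun_prop))]
      congr 1
      ext p
      have : k ⬝ᵥ p.1 = -(α ⬝ᵥ A *ᵥ p.1) := by
        rw [hk, neg_dotProduct, dotProduct_mulVec, mulVec_transpose]
      simp [this]
    rw [e, aux_gauss_var, Real.coe_toNNReal _ hkk0, hkk, aux_gauss_Iio,
      ENNReal.toReal_ofReal (aux_nCdf_nonneg _)]
  refine ⟨hfirst, fun B hB => ?_⟩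
  rw [hfirst, integral_div]
  congr 1
  have hsetB : MeasurableSet {p : (Fin d → ℝ) × ℝ | p.1 ∈ B ∧ p.2 < α ⬝ᵥ p.1 + τ} :=
    (measurable_fst hB).inter hset
  have hcm : Measurable fun y : Fin d → ℝ => nCdf (α ⬝ᵥ y + τ) :=
    aux_nCdf_meas.comp (hαm.add_const _)
  rw [integral_eq_lintegral_of_nonneg_ae
    (ae_of_all _ fun y => mul_nonneg (hnn y) (aux_nCdf_nonneg _))
    (hmm.mul hcm).aestronglyMeasurable, hμ', Measure.prod_apply hsetB]
  congr 1
  rw [lintegral_withDensity_eq_lintegral_mul _ hmm.ennreal_ofReal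
    (measurable_measure_prodMk_left hsetB), ← lintegral_indicator hB]
  refine lintegral_congr fun y => ?_
  by_cases hy : y ∈ B
  · simp only [Pi.mul_apply, indicator_of_mem hy, ENNReal.ofReal_mul (hnn y), ← aux_gauss_Iio]
    congr 2
    ext x; simp [hy]
  · simp [hy]
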